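/- arXiv:1509.02840 — 4 statements merged into one kernel-verified Lean document; each statement's English description precedes it below -/
import Mathlib

section
/- Let F_i, F_j ∈ ℝ^{m×n} be matrices, G_i, G_j ∈ ℝ^m, and let h ∈ ℝⁿ be a nonzero row vector and k ∈ ℝ. Assume the two affine maps agree on the hyperplane h·z = k, i.e., F_i z + G_i = F_j z + G_j for every z ∈ ℝⁿ with h·z = k. Then for every x ∈ ℝⁿ, ‖F_i x + G_i − F_j x − G_j‖_∞ = (|h·x − k|/‖h‖₂²)·‖(F_i − F_j) hᵀ‖_∞. -/
open Matrix BigOperators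

/-- If two affine maps `z ↦ Fᵢ z + Gᵢ` and `z ↦ Fⱼ z + Gⱼ` agree on the hyperplane `h·z = k`
(`h ≠ 0`), then their difference at any point `x` has `∞`-norm
`(|h·x − k|/‖h‖₂²)·‖(Fᵢ − Fⱼ)hᵀ‖_∞`. -/
theorem affine_pieces_difference_eq {m n : ℕ}
    (Fi Fj : Matrix (Fin m) (Fin n) ℝ) (Gi Gj : Fin m → ℝ)
    (h : Fin n → ℝ) (hne : h ≠ 0) (k : ℝ)
    (hagree : ∀ z : Fin n → ℝ, h ⬝ᵥ z = k → Fi *ᵥ z + Gi = Fj *ᵥ z + Gj) :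
    ∀ x : Fin n → ℝ,
      ‖Fi *ᵥ x + Gi - (Fj *ᵥ x + Gj)‖ =
        (|h ⬝ᵥ x - k| / (∑ i, (h i) ^ 2)) * ‖(Fi - Fj) *ᵥ h‖ := by
  intro x
  have hsq : ∑ i, (h i) ^ 2 = h ⬝ᵥ h := by simp [dotProduct, sq]
  have hS : h ⬝ᵥ h ≠ 0 := fun h0 => hne (dotProduct_self_eq_zero.mp h0)
  have hS_nonneg : 0 ≤ h ⬝ᵥ h := hsq ▸ Finset.sum_nonneg fun i _ => sq_nonneg (h i)
  set t : ℝ := (h ⬝ᵥ x - k) / (h ⬝ᵥ h) with ht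
  have hz := hagree (x - t • h) (by
    rw [dotProduct_sub, dotProduct_smul, smul_eq_mul, ht, div_mul_cancel₀ _ hS, sub_sub_cancel])
  have key : Fi *ᵥ x + Gi - (Fj *ᵥ x + Gj) = t • ((Fi - Fj) *ᵥ h) := by
    simp only [mulVec_sub, mulVec_smul] at hz
    rw [sub_mulVec, smul_sub, ← sub_eq_zero]
    rw [← sub_eq_zero] at hz
    rw [← hz]
    abel
  rw [key, norm_smul, Real.norm_eq_abs, ht, abs_div, abs_of_nonneg hS_nonneg, hsq]
end

section
/- Let F_i, F_j ∈ ℝ^{m×n}, G_i, G_j ∈ ℝ^m, let h ∈ ℝⁿ be a nonzero row vector, k ∈ ℝ, and δ ≥ 0. Assume F_i z + G_i = F_j z + G_j for every z ∈ ℝⁿ with h·z = k. Then for every x ∈ ℝⁿ with |h·x − k| ≤ δ, ‖F_i x + G_i − F_j x − G_j‖_∞ ≤ (δ/‖h‖₂²)·‖(F_i − F_j) hᵀ‖_∞. -/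
open Matrix BigOperators

/-- If two affine maps agree on the hyperplane `h·z = k` (`h ≠ 0`), then at any `x` with
`|h·x − k| ≤ δ` their difference is bounded by `(δ/‖h‖₂²)·‖(Fᵢ − Fⱼ)hᵀ‖_∞`. -/
theorem affine_pieces_difference_le {m n : ℕ}
    (Fi Fj : Matrix (Fin m) (Fin n) ℝ) (Gi Gj : Fin m → ℝ)
    (h : Fin n → ℝ) (hne : h ≠ 0) (k δ : ℝ) (hδ : 0 ≤ δ)
    (hagree : ∀ z : Fin n → ℝ, h ⬝ᵥ z = k → Fi *ᵥ z + Gi = Fj *ᵥ z + Gj) :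
    ∀ x : Fin n → ℝ, |h ⬝ᵥ x - k| ≤ δ →
      ‖Fi *ᵥ x + Gi - (Fj *ᵥ x + Gj)‖ ≤
        (δ / (∑ i, (h i) ^ 2)) * ‖(Fi - Fj) *ᵥ h‖ := by
  intro x hx
  have hS : ∑ i, (h i) ^ 2 = h ⬝ᵥ h := by simp [dotProduct, sq]
  have hS_ne : h ⬝ᵥ h ≠ 0 := fun h0 => hne (dotProduct_self_eq_zero.mp h0)
  have hS_nonneg : 0 ≤ h ⬝ᵥ h := hS ▸ Finset.sum_nonneg fun i _ => sq_nonneg (h i)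
  rw [hS]
  set t := (h ⬝ᵥ x - k) / (h ⬝ᵥ h) with ht
  have hz : h ⬝ᵥ (x - t • h) = k := by
    rw [dotProduct_sub, dotProduct_smul, smul_eq_mul, ht, div_mul_cancel₀ _ hS_ne]
    ring
  have hdiff : Fi *ᵥ x + Gi - (Fj *ᵥ x + Gj) = t • ((Fi - Fj) *ᵥ h) := by
    have hproj := hagree _ hz
    simp only [mulVec_sub, mulVec_smul] at hproj
    rw [sub_mulVec, smul_sub]
    linear_combination hproj
  rw [hdiff, norm_smul, Real.norm_eq_abs, ht, abs_div, abs_of_nonneg hS_nonneg]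
  gcongr
end

section
/- Let F_i, F_j ∈ ℝ^{m×n}, G_i, G_j ∈ ℝ^m, let h ∈ ℝⁿ be a nonzero row vector, k ∈ ℝ, and ε ≥ 0. Let x, Δx ∈ ℝⁿ, ΔF_i ∈ ℝ^{m×n}, ΔG_i ∈ ℝ^m with ‖Δx‖_∞ ≤ ε, and set x̂ = x + Δx, F̂_i = F_i + ΔF_i, Ĝ_i = G_i + ΔG_i, and δ = ε(‖h‖₁ + ‖x‖₁ + nε + 1). Assume: (i) F_i z + G_i = F_j z + G_j for every z ∈ ℝⁿ with h·z = k (continuity of the piecewise affine control law across the shared facet); and (ii) |h·x − k| ≤ δ. Then ‖F̂_i x̂ + Ĝ_i − (F_j x + G_j)‖_∞ ≤ (δ/‖h‖₂²)·‖(F_i − F_j) hᵀ‖_∞ + ‖F_i Δx + ΔF_i x + ΔF_i Δx + ΔG_i‖_∞. -/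
open Matrix BigOperators

/-- Two affine maps that agree on the hyperplane `h ⬝ᵥ z = k` differ at `x` by the multiple of
`(A - B) *ᵥ h` given by the signed displacement of `x` from that hyperplane. -/
theorem affine_sub_eq_smul_of_agree_on_hyperplane {m n : ℕ}
    {A B : Matrix (Fin m) (Fin n) ℝ} {a b : Fin m → ℝ} {h : Fin n → ℝ} (hne : h ≠ 0) {k : ℝ}
    (hagree : ∀ z : Fin n → ℝ, h ⬝ᵥ z = k → A *ᵥ z + a = B *ᵥ z + b) (x : Fin n → ℝ) :
    A *ᵥ x + a - (B *ᵥ x + b) = ((h ⬝ᵥ x - k) / (h ⬝ᵥ h)) • ((A - B) *ᵥ h) := by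
  have hh : h ⬝ᵥ h ≠ 0 := fun h0 => hne (dotProduct_self_eq_zero.mp h0)
  have hz := hagree (x - ((h ⬝ᵥ x - k) / (h ⬝ᵥ h)) • h) (by
    rw [dotProduct_sub, dotProduct_smul, smul_eq_mul, div_mul_cancel₀ _ hh]
    ring)
  rw [mulVec_sub, mulVec_sub, mulVec_smul, mulVec_smul] at hz
  rw [sub_mulVec, smul_sub]
  linear_combination hz

/-- Theorem 1 (main bound): error of the quantized explicit MPC control when the true state
lies in region `P_j` while the quantized state lies in the quantized region `P̂_i` across the
separating hyperplane `h·z = k`. -/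
theorem quantized_empc_main_bound {m n : ℕ}
    (Fi Fj ΔFi : Matrix (Fin m) (Fin n) ℝ) (Gi Gj ΔGi : Fin m → ℝ)
    (h : Fin n → ℝ) (hne : h ≠ 0) (k ε : ℝ) (hε : 0 ≤ ε)
    (x Δx : Fin n → ℝ) (hΔx : ‖Δx‖ ≤ ε)
    (hagree : ∀ z : Fin n → ℝ, h ⬝ᵥ z = k → Fi *ᵥ z + Gi = Fj *ᵥ z + Gj)
    (hjump : |h ⬝ᵥ x - k| ≤ ε * ((∑ i, |h i|) + (∑ i, |x i|) + (n : ℝ) * ε + 1)) :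
    ‖(Fi + ΔFi) *ᵥ (x + Δx) + (Gi + ΔGi) - (Fj *ᵥ x + Gj)‖ ≤
      (ε * ((∑ i, |h i|) + (∑ i, |x i|) + (n : ℝ) * ε + 1) / (∑ i, (h i) ^ 2)) *
          ‖(Fi - Fj) *ᵥ h‖ +
        ‖Fi *ᵥ Δx + ΔFi *ᵥ x + ΔFi *ᵥ Δx + ΔGi‖ := by
  have hS : ∑ i, (h i) ^ 2 = h ⬝ᵥ h := by simp only [dotProduct, sq]
  have hS0 : 0 ≤ h ⬝ᵥ h := hS ▸ Finset.sum_nonneg fun i _ => sq_nonneg (h i)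
  have hsplit : (Fi + ΔFi) *ᵥ (x + Δx) + (Gi + ΔGi) - (Fj *ᵥ x + Gj) =
      ((h ⬝ᵥ x - k) / (h ⬝ᵥ h)) • ((Fi - Fj) *ᵥ h) +
        (Fi *ᵥ Δx + ΔFi *ᵥ x + ΔFi *ᵥ Δx + ΔGi) := by
    rw [← affine_sub_eq_smul_of_agree_on_hyperplane hne hagree x, add_mulVec, mulVec_add,
      mulVec_add]
    abel
  rw [hsplit, hS]
  refine (norm_add_le _ _).trans ?_
  rw [norm_smul, Real.norm_eq_abs, abs_div, abs_of_nonneg hS0]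
  gcongr
end

section
/- Let F_i, F_j ∈ ℝ^{m×n}, G_i, G_j ∈ ℝ^m, let h ∈ ℝⁿ be a nonzero row vector, k ∈ ℝ, and ε ≥ 0. Let x, Δx ∈ ℝⁿ, ΔF_i ∈ ℝ^{m×n}, ΔG_i ∈ ℝ^m with ‖Δx‖_∞ ≤ ε, every entry of ΔF_i of absolute value at most ε, and ‖ΔG_i‖_∞ ≤ ε. Set x̂ = x + Δx, F̂_i = F_i + ΔF_i, Ĝ_i = G_i + ΔG_i, and δ = ε(‖h‖₁ + ‖x‖₁ + nε + 1). Assume F_i z + G_i = F_j z + G_j for every z ∈ ℝⁿ with h·z = k, and |h·x − k| ≤ δ. Then ‖F̂_i x̂ + Ĝ_i − (F_j x + G_j)‖_∞ ≤ (δ/‖h‖₂²)·‖(F_i − F_j) hᵀ‖_∞ + ε(‖F_i‖_∞ + n‖x‖_∞ + nε + 1), where for a matrix A, ‖A‖_∞ is the operator norm induced by the vector ∞-norm (maximum absolute row sum). -/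
open Matrix BigOperators

/-- The operator norm induced by the vector `∞`-norm: the maximum absolute row sum. -/
noncomputable def matNormInf {m n : ℕ} (A : Matrix (Fin m) (Fin n) ℝ) : ℝ :=
  ‖(fun i : Fin m => ∑ j, |A i j|)‖

theorem norm_mulVec_le_matNormInf {m n : ℕ} (A : Matrix (Fin m) (Fin n) ℝ) (v : Fin n → ℝ) :
    ‖A *ᵥ v‖ ≤ matNormInf A * ‖v‖ := by
  refine (pi_norm_le_iff_of_nonneg (mul_nonneg (norm_nonneg _) (norm_nonneg v))).2 fun i => ?_
  have hrow : ∑ j, |A i j| ≤ matNormInf A :=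
    (le_abs_self _).trans (norm_le_pi_norm (fun i : Fin m => ∑ j, |A i j|) i)
  calc ‖(A *ᵥ v) i‖ ≤ ∑ j, ‖A i j * v j‖ := by
        simpa only [mulVec, dotProduct] using norm_sum_le Finset.univ fun j => A i j * v j
    _ ≤ ∑ j, |A i j| * ‖v‖ := by
        refine Finset.sum_le_sum fun j _ => ?_
        rw [norm_mul, Real.norm_eq_abs (A i j)]
        exact mul_le_mul_of_nonneg_left (norm_le_pi_norm v j) (abs_nonneg _)
    _ = (∑ j, |A i j|) * ‖v‖ := (Finset.sum_mul _ _ _).symm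
    _ ≤ matNormInf A * ‖v‖ := mul_le_mul_of_nonneg_right hrow (norm_nonneg v)

theorem matNormInf_le_of_entries {m n : ℕ} {A : Matrix (Fin m) (Fin n) ℝ} {ε : ℝ} (hε : 0 ≤ ε)
    (hA : ∀ i j, |A i j| ≤ ε) : matNormInf A ≤ n * ε := by
  refine (pi_norm_le_iff_of_nonneg (by positivity)).2 fun i => ?_
  rw [Real.norm_of_nonneg (Finset.sum_nonneg fun j _ => abs_nonneg _)]
  calc ∑ j, |A i j| ≤ ∑ _j : Fin n, ε := Finset.sum_le_sum fun j _ => hA i j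
    _ = n * ε := by simp

/-- Theorem 1 with the a priori bound for the quantization error term. -/
theorem quantized_empc_apriori_bound {m n : ℕ}
    (Fi Fj ΔFi : Matrix (Fin m) (Fin n) ℝ) (Gi Gj ΔGi : Fin m → ℝ)
    (h : Fin n → ℝ) (hne : h ≠ 0) (k ε : ℝ) (hε : 0 ≤ ε)
    (x Δx : Fin n → ℝ) (hΔx : ‖Δx‖ ≤ ε)
    (hΔF : ∀ i j, |ΔFi i j| ≤ ε) (hΔG : ‖ΔGi‖ ≤ ε)
    (hagree : ∀ z : Fin n → ℝ, h ⬝ᵥ z = k → Fi *ᵥ z + Gi = Fj *ᵥ z + Gj)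
    (hjump : |h ⬝ᵥ x - k| ≤ ε * ((∑ i, |h i|) + (∑ i, |x i|) + (n : ℝ) * ε + 1)) :
    ‖(Fi + ΔFi) *ᵥ (x + Δx) + (Gi + ΔGi) - (Fj *ᵥ x + Gj)‖ ≤
      (ε * ((∑ i, |h i|) + (∑ i, |x i|) + (n : ℝ) * ε + 1) / (∑ i, (h i) ^ 2)) *
          ‖(Fi - Fj) *ᵥ h‖ +
        ε * (matNormInf Fi + (n : ℝ) * ‖x‖ + (n : ℝ) * ε + 1) := by
  have hS : (∑ i, (h i) ^ 2) = h ⬝ᵥ h := by simp only [dotProduct, sq]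
  have hpos : 0 ≤ h ⬝ᵥ h := hS ▸ Finset.sum_nonneg fun i _ => sq_nonneg _
  have hsplit : (Fi + ΔFi) *ᵥ (x + Δx) + (Gi + ΔGi) - (Fj *ᵥ x + Gj) =
      (Fi *ᵥ x + Gi - (Fj *ᵥ x + Gj)) + (Fi *ᵥ Δx + ΔFi *ᵥ x + ΔFi *ᵥ Δx + ΔGi) := by
    rw [add_mulVec, mulVec_add, mulVec_add]
    abel
  have hΔ : matNormInf ΔFi ≤ n * ε := matNormInf_le_of_entries hε hΔF
  have h1 : ‖Fi *ᵥ Δx‖ ≤ matNormInf Fi * ε :=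
    (norm_mulVec_le_matNormInf Fi Δx).trans (mul_le_mul_of_nonneg_left hΔx (norm_nonneg _))
  have h2 : ‖ΔFi *ᵥ x‖ ≤ n * ε * ‖x‖ :=
    (norm_mulVec_le_matNormInf ΔFi x).trans (mul_le_mul_of_nonneg_right hΔ (norm_nonneg _))
  have h3 : ‖ΔFi *ᵥ Δx‖ ≤ n * ε * ε :=
    (norm_mulVec_le_matNormInf ΔFi Δx).trans
      (mul_le_mul hΔ hΔx (norm_nonneg _) (by positivity))
  rw [hsplit, affine_sub_eq_smul_of_agree_on_hyperplane hne hagree x, hS]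
  refine (norm_add_le _ _).trans (add_le_add ?_ ?_)
  · rw [norm_smul, norm_div, Real.norm_eq_abs (h ⬝ᵥ x - k), Real.norm_of_nonneg hpos]
    exact mul_le_mul_of_nonneg_right (div_le_div_of_nonneg_right hjump hpos) (norm_nonneg _)
  · calc ‖Fi *ᵥ Δx + ΔFi *ᵥ x + ΔFi *ᵥ Δx + ΔGi‖
        ≤ ‖Fi *ᵥ Δx‖ + ‖ΔFi *ᵥ x‖ + ‖ΔFi *ᵥ Δx‖ + ‖ΔGi‖ := norm_add₄_le
      _ ≤ matNormInf Fi * ε + n * ε * ‖x‖ + n * ε * ε + ε := by gcongr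
      _ = ε * (matNormInf Fi + (n : ℝ) * ‖x‖ + (n : ℝ) * ε + 1) := by ring
end
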